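/- Let step₁ and step₂ be labeled transition systems over state types σ₁ and σ₂ with the same event type ν, with multi-step closures star₁, star₂ and plus₂ (at least one step). Let Init₁ ⊆ σ₁ and Init₂ ⊆ σ₂ be sets of initial states, final₁ : σ₁ → ℤ → Prop and final₂ : σ₂ → ℤ → Prop be final-state predicates, sim : σ₁ → σ₂ → Prop, m : σ₁ → M a measure into a type M carrying a well-founded relation ≺. Assume: (initial states) for all S₁ ∈ Init₁ and S₂ ∈ Init₂, sim S₁ S₂; (final states) if sim S₁ S₂ and final₁ S₁ n then final₂ S₂ n; (star simulation) if sim S₁ S₂ and step₁ S₁ t S₁' then either there exists S₂' with plus₂ S₂ t S₂' and sim S₁' S₂', or m S₁' ≺ m S₁ and there exists S₂' with star₂ S₂ t S₂' and sim S₁' S₂'; and Init₂ is nonempty. Then converging behaviors are preserved: if there exist S₁ ∈ Init₁ and S₁' with star₁ S₁ t S₁' and final₁ S₁' n, then there exist S₂ ∈ Init₂ and S₂' with star₂ S₂ t S₂' and final₂ S₂' n. -/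

import Mathlib

/-- Reflexive-transitive closure of a labeled transition system, concatenating traces. -/
inductive LTSStar {σ ν : Type*} (step : σ → List ν → σ → Prop) : σ → List ν → σ → Prop
  | refl (s : σ) : LTSStar step s [] s
  | step {s s' s'' : σ} {t t' : List ν} :
      step s t s' → LTSStar step s' t' s'' → LTSStar step s (t ++ t') s''

/-- Transitive closure (at least one step) of a labeled transition system. -/
inductive LTSPlus {σ ν : Type*} (step : σ → List ν → σ → Prop) : σ → List ν → σ → Prop
  | step {s s' s'' : σ} {t t' : List ν} :
      step s t s' → LTSStar step s' t' s'' → LTSPlus step s (t ++ t') s''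

namespace LTSStar

variable {σ ν : Type*} {step : σ → List ν → σ → Prop}

theorem trans {s s' s'' : σ} {t t' : List ν} (h : LTSStar step s t s')
    (h' : LTSStar step s' t' s'') : LTSStar step s (t ++ t') s'' := by
  induction h with
  | refl => exact h'
  | step hs _ ih => rw [List.append_assoc]; exact .step hs (ih h')

theorem of_plus {s s' : σ} {t : List ν} (h : LTSPlus step s t s') : LTSStar step s t s' := by
  cases h with
  | step hs hstar => exact .step hs hstar

/-- A simulation matching single steps by finite executions also matches finite executions. -/
theorem simulate {σ' : Type*} {step' : σ' → List ν → σ' → Prop} {sim : σ → σ' → Prop}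
    (hsim : ∀ s s' t u, sim s s' → step s t u → ∃ u', LTSStar step' s' t u' ∧ sim u u')
    {s u : σ} {t : List ν} (h : LTSStar step s t u) {s' : σ'} (hs : sim s s') :
    ∃ u', LTSStar step' s' t u' ∧ sim u u' := by
  induction h generalizing s' with
  | refl => exact ⟨s', .refl s', hs⟩
  | step hstep _ ih =>
    obtain ⟨v', hv', hv⟩ := hsim _ _ _ _ hs hstep
    obtain ⟨u', hu', hu⟩ := ih hv
    exact ⟨u', hv'.trans hu', hu⟩

end LTSStar

/-- A "star" simulation (with a well-founded measure ruling out stuttering)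
preserves converging behaviors. -/
theorem star_simulation_preserves_convergence {σ₁ σ₂ ν M : Type*}
    (step₁ : σ₁ → List ν → σ₁ → Prop) (step₂ : σ₂ → List ν → σ₂ → Prop)
    (Init₁ : Set σ₁) (Init₂ : Set σ₂)
    (final₁ : σ₁ → ℤ → Prop) (final₂ : σ₂ → ℤ → Prop)
    (sim : σ₁ → σ₂ → Prop)
    (m : σ₁ → M) (r : M → M → Prop) (hwf : WellFounded r)
    (hinit : ∀ S₁ ∈ Init₁, ∀ S₂ ∈ Init₂, sim S₁ S₂)
    (hfinal : ∀ S₁ S₂ n, sim S₁ S₂ → final₁ S₁ n → final₂ S₂ n)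
    (hsim : ∀ S₁ S₂ t S₁', sim S₁ S₂ → step₁ S₁ t S₁' →
      (∃ S₂', LTSPlus step₂ S₂ t S₂' ∧ sim S₁' S₂') ∨
      (r (m S₁') (m S₁) ∧ ∃ S₂', LTSStar step₂ S₂ t S₂' ∧ sim S₁' S₂'))
    (hne : Init₂.Nonempty) :
    ∀ t n, (∃ S₁ ∈ Init₁, ∃ S₁', LTSStar step₁ S₁ t S₁' ∧ final₁ S₁' n) →
      ∃ S₂ ∈ Init₂, ∃ S₂', LTSStar step₂ S₂ t S₂' ∧ final₂ S₂' n := by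
  rintro t n ⟨S₁, hS₁, S₁', hstar, hfin⟩
  obtain ⟨S₂, hS₂⟩ := hne
  have hstep : ∀ S₁ S₂ t S₁', sim S₁ S₂ → step₁ S₁ t S₁' →
      ∃ S₂', LTSStar step₂ S₂ t S₂' ∧ sim S₁' S₂' := by
    intro S₁ S₂ t S₁' hs h
    rcases hsim S₁ S₂ t S₁' hs h with ⟨S₂', hplus, hs'⟩ | ⟨-, h'⟩
    · exact ⟨S₂', .of_plus hplus, hs'⟩
    · exact h'
  obtain ⟨S₂', hstar', hs'⟩ := hstar.simulate hstep (hinit S₁ hS₁ S₂ hS₂)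
  exact ⟨S₂, hS₂, S₂', hstar', hfinal _ _ _ hs' hfin⟩
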